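/- Suppose ν ≥ 1 and let B ⊆ Ω with B ≠ Ω and ∂B ≠ ∅ be such that every activation transition from a boundary state stays in B: for every u ∈ ∂B and every i ∈ V with u + e_i ∈ Ω, one has u + e_i ∈ B. Then π(B)/Q(B) ≥ ν^{K(B,V) − K(∂B,V)} / (N |∂B|). (This is the estimate of Example 1, showing that the expected return time out of B grows geometrically in the gap between the maximum number of active nodes in B and on its boundary.) -/

import Mathlib

open Finset

/-- (Estimate of Example 1.) With equal activity factors `ν ≥ 1`, if
`B ⊆ Ω`, `B ≠ Ω`, `Bd ≠ ∅`, and every activation transition from a boundary state stays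
in `B`, then `π(B)/Q(B) ≥ ν^{K(B,V) − K(Bd,V)}/(N |Bd|)`, where `K(S',V)` is the maximum
number of active nodes over states in `S'` and `Bd` is the boundary of `B`. -/
theorem example_return_time_bound
    {V : Type*} [Fintype V] [DecidableEq V] (G : SimpleGraph V)
    (ν : ℝ) (hν : 1 ≤ ν)
    (Ω : Finset (Finset V))
    (hΩ : ∀ s : Finset V, s ∈ Ω ↔ ∀ i ∈ s, ∀ j ∈ s, i ≠ j → ¬ G.Adj i j)
    (Z : ℝ) (hZ : Z = ∑ s ∈ Ω, ν ^ s.card)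
    (π : Finset V → ℝ) (hπ : ∀ s : Finset V, π s = ν ^ s.card / Z)
    (q : Finset V → Finset V → ℝ)
    (hq : ∀ u v : Finset V, u ∈ Ω → v ∈ Ω → u ≠ v →
      q u v = (∑ i : V, if i ∉ u ∧ v = insert i u then ν else 0)
            + (∑ i : V, if i ∈ u ∧ v = u.erase i then 1 else 0))
    (hq0 : ∀ u v : Finset V, u ∉ Ω ∨ v ∉ Ω → q u v = 0)
    (Q : Finset (Finset V) → ℝ)
    (hQ : ∀ B' : Finset (Finset V), Q B' = ∑ u ∈ B', ∑ u' ∈ Ω \ B', π u * q u u')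
    (B : Finset (Finset V)) (hBΩ : B ⊆ Ω) (hBne : B ≠ Ω)
    (Bd : Finset (Finset V))
    (hBd : Bd = B.filter (fun u => ∃ u' ∈ Ω \ B, 0 < q u u'))
    (hBdne : Bd.Nonempty)
    (hclosed : ∀ u ∈ Bd, ∀ i : V, i ∉ u → insert i u ∈ Ω → insert i u ∈ B) :
    (∑ u ∈ B, π u) / Q B ≥
      ν ^ (B.sup Finset.card - Bd.sup Finset.card) /
        ((Fintype.card V : ℝ) * (Bd.card : ℝ)) := by
  have hν0 : 0 < ν := by linarith
  have hBdB : Bd ⊆ B := by rw [hBd]; exact filter_subset _ _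
  obtain ⟨w, hw⟩ := hBdne
  have hZpos : 0 < Z := by
    rw [hZ]
    exact sum_pos (fun s _ => pow_pos hν0 _) ⟨w, hBΩ (hBdB hw)⟩
  have hπpos : ∀ s, 0 < π s := fun s => by
    rw [hπ]
    exact div_pos (pow_pos hν0 _) hZpos
  have hqnn : ∀ u ∈ B, ∀ u' ∈ Ω \ B, 0 ≤ q u u' := by
    intro u hu u' hu'
    obtain ⟨h1, h2⟩ := mem_sdiff.1 hu'
    rw [hq u u' (hBΩ hu) h1 (fun h => h2 (h ▸ hu))]
    refine add_nonneg (sum_nonneg fun i _ => ?_) (sum_nonneg fun i _ => ?_) <;>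
      split_ifs <;> linarith
  have hqle : ∀ u ∈ Bd, ∀ u' ∈ Ω \ B,
      q u u' ≤ ∑ i : V, if u' = u.erase i then 1 else 0 := by
    intro u hu u' hu'
    obtain ⟨h1, h2⟩ := mem_sdiff.1 hu'
    rw [hq u u' (hBΩ (hBdB hu)) h1 (fun h => h2 (h ▸ hBdB hu))]
    have hz : (∑ i : V, if i ∉ u ∧ u' = insert i u then ν else 0) = 0 := by
      refine sum_eq_zero fun i _ => if_neg ?_
      rintro ⟨hi, rfl⟩
      exact h2 (hclosed u hu i hi h1)
    rw [hz, zero_add]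
    refine sum_le_sum fun i _ => ?_
    split_ifs with h3 h4
    · rfl
    · exact absurd h3.2 h4
    · exact zero_le_one
    · rfl
  have hrate : ∀ u ∈ Bd, ∑ u' ∈ Ω \ B, q u u' ≤ Fintype.card V := by
    intro u hu
    calc ∑ u' ∈ Ω \ B, q u u'
        ≤ ∑ u' ∈ Ω \ B, ∑ i : V, (if u' = u.erase i then 1 else 0 : ℝ) :=
          sum_le_sum (hqle u hu)
      _ = ∑ i : V, ∑ u' ∈ Ω \ B, (if u' = u.erase i then 1 else 0 : ℝ) := sum_comm
      _ ≤ ∑ _i : V, (1 : ℝ) := by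
          refine sum_le_sum fun i _ => ?_
          rw [sum_ite_eq']
          split_ifs <;> norm_num
      _ = Fintype.card V := by simp
  have hQBd : Q B = ∑ u ∈ Bd, π u * ∑ u' ∈ Ω \ B, q u u' := by
    simp only [hQ, mul_sum]
    refine (sum_subset hBdB fun u hu hn => sum_eq_zero fun u' hu' => ?_).symm
    have hle : ¬ 0 < q u u' := fun h => hn (hBd ▸ mem_filter.2 ⟨hu, u', hu', h⟩)
    rw [le_antisymm (not_lt.1 hle) (hqnn u hu u' hu'), mul_zero]
  have hQpos : 0 < Q B := by
    rw [hQBd]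
    refine sum_pos (fun u hu => mul_pos (hπpos u) ?_) ⟨w, hw⟩
    obtain ⟨u', hu', hpos⟩ := (mem_filter.1 (hBd ▸ hu)).2
    exact sum_pos' (hqnn u (hBdB hu)) ⟨u', hu', hpos⟩
  have hQle : Q B ≤ Fintype.card V * Bd.card * (ν ^ Bd.sup Finset.card / Z) := by
    rw [hQBd]
    calc ∑ u ∈ Bd, π u * ∑ u' ∈ Ω \ B, q u u'
        ≤ ∑ _u ∈ Bd, ν ^ Bd.sup Finset.card / Z * Fintype.card V := by
          refine sum_le_sum fun u hu =>
            mul_le_mul ?_ (hrate u hu) (sum_nonneg (hqnn u (hBdB hu))) (by positivity)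
          rw [hπ]
          gcongr
          · exact le_sup (f := Finset.card) hu
      _ = Fintype.card V * Bd.card * (ν ^ Bd.sup Finset.card / Z) := by
          rw [sum_const, nsmul_eq_mul]
          ring
  have hπle : ν ^ B.sup Finset.card / Z ≤ ∑ u ∈ B, π u := by
    obtain ⟨m, hm, hmax⟩ := exists_mem_eq_sup B ⟨w, hBdB hw⟩ Finset.card
    rw [hmax, ← hπ]
    exact single_le_sum (fun s _ => (hπpos s).le) hm
  have hNpos : 0 < (Fintype.card V : ℝ) * Bd.card := by
    refine pos_of_mul_pos_left (hQpos.trans_le hQle) ?_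
    positivity
  rw [ge_iff_le, div_le_div_iff₀ hNpos hQpos]
  calc ν ^ (B.sup Finset.card - Bd.sup Finset.card) * Q B
      ≤ ν ^ (B.sup Finset.card - Bd.sup Finset.card) *
          (Fintype.card V * Bd.card * (ν ^ Bd.sup Finset.card / Z)) := by gcongr
    _ = ν ^ B.sup Finset.card / Z * (Fintype.card V * Bd.card) := by
        rw [← Nat.sub_add_cancel (sup_mono hBdB : Bd.sup Finset.card ≤ B.sup Finset.card),
          pow_add, Nat.add_sub_cancel]
        ring
    _ ≤ (∑ u ∈ B, π u) * (Fintype.card V * Bd.card) := by gcongr
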